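/- B = A[X;*]^fl is associative if and only if A is associative and commutative. -/

import Mathlib

/-- `tau n a b = ab` if `n` is even and `ba` if `n` is odd. -/
def tau {A : Type*} [NonAssocRing A] (n : ℕ) (a b : A) : A :=
  if Even n then a * b else b * a

/-- The `m`-fold iterate `*^m` of the involution `*`. -/
def starIter {A : Type*} [NonAssocRing A] [StarRing A] : ℕ → A → A
  | 0, a => a
  | m+1, a => star (starIter m a)

/-- The multiplication of the flipped non-associative skew polynomial ring `B = A[X;*]^fl`:
the biadditive extension of `(aX^m)(bX^n) = τ_n(a, *^m(b)) X^{m+n}`. Polynomials are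
represented as finitely supported functions `ℕ →₀ A`. -/
noncomputable def fmul {A : Type*} [NonAssocRing A] [StarRing A] (p q : ℕ →₀ A) : ℕ →₀ A :=
  p.sum fun m a => q.sum fun n b => Finsupp.single (m+n) (tau n a (starIter m b))

/-- The map `α : B → B`, `α(Σ_i a_i X^i) = Σ_i (−1)^i *^{i+1}(a_i) X^i`. -/
noncomputable def alphaMap {A : Type*} [NonAssocRing A] [StarRing A] (p : ℕ →₀ A) : ℕ →₀ A :=
  p.sum fun i a => Finsupp.single i ((-1 : ℤ) ^ i • starIter (i+1) a)

/-- The map `β : B → B`, `β(Σ_i a_i X^i) = Σ_i *^{i+1}(a_i) X^i`. -/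
noncomputable def betaMap {A : Type*} [NonAssocRing A] [StarRing A] (p : ℕ →₀ A) : ℕ →₀ A :=
  p.sum fun i a => Finsupp.single i (starIter (i+1) a)

section FlippedSkewPolynomial

variable {A : Type*} [NonAssocRing A]

theorem tau_zero_left (n : ℕ) (b : A) : tau n 0 b = 0 := by
  simp [tau]

theorem tau_zero_right (n : ℕ) (a : A) : tau n a 0 = 0 := by
  simp [tau]

theorem tau_add_left (n : ℕ) (a b c : A) : tau n (a + b) c = tau n a c + tau n b c := by
  unfold tau; split_ifs <;> simp [add_mul, mul_add]

theorem tau_add_right (n : ℕ) (a b c : A) : tau n a (b + c) = tau n a b + tau n a c := by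
  unfold tau; split_ifs <;> simp [add_mul, mul_add]

theorem tau_eq_mul (h : ∀ a b : A, a * b = b * a) (n : ℕ) (a b : A) : tau n a b = a * b := by
  simp [tau, h b a]

variable [StarRing A]

theorem starIter_zero_right (m : ℕ) : starIter m (0 : A) = 0 := by
  induction m with
  | zero => rfl
  | succ m ih => simp [starIter, ih]

theorem starIter_add_right (m : ℕ) (a b : A) :
    starIter m (a + b) = starIter m a + starIter m b := by
  induction m with
  | zero => rfl
  | succ m ih => simp [starIter, ih]

theorem starIter_mul (h : ∀ a b : A, a * b = b * a) (m : ℕ) (a b : A) :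
    starIter m (a * b) = starIter m a * starIter m b := by
  induction m with
  | zero => rfl
  | succ m ih => rw [starIter, ih, star_mul, h]; rfl

theorem starIter_starIter (m n : ℕ) (a : A) : starIter m (starIter n a) = starIter (m + n) a := by
  induction m with
  | zero => simp [starIter]
  | succ m ih => rw [starIter, ih, Nat.succ_add]; rfl

theorem fmul_zero_left (q : ℕ →₀ A) : fmul 0 q = 0 :=
  Finsupp.sum_zero_index

theorem fmul_zero_right (p : ℕ →₀ A) : fmul p 0 = 0 := by
  simp [fmul]

theorem fmul_add_left (p p' q : ℕ →₀ A) : fmul (p + p') q = fmul p q + fmul p' q := by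
  unfold fmul
  apply Finsupp.sum_add_index'
  · simp [tau_zero_left]
  · simp [tau_add_left, Finsupp.sum_add]

theorem fmul_add_right (p q q' : ℕ →₀ A) : fmul p (q + q') = fmul p q + fmul p q' := by
  unfold fmul
  rw [← Finsupp.sum_add]
  refine Finsupp.sum_congr fun m _ => Finsupp.sum_add_index' ?_ ?_
  · simp [tau_zero_right, starIter_zero_right]
  · simp [tau_add_right, starIter_add_right]

theorem fmul_single_single (m n : ℕ) (a b : A) :
    fmul (Finsupp.single m a) (Finsupp.single n b) =
      Finsupp.single (m + n) (tau n a (starIter m b)) := by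
  unfold fmul
  rw [Finsupp.sum_single_index, Finsupp.sum_single_index]
  · simp [tau_zero_right, starIter_zero_right]
  · simp [tau_zero_left]

/-- Associativity of `fmul` may be checked on monomials. -/
theorem fmul_assoc_of_single
    (h : ∀ (m n k : ℕ) (a b c : A),
      fmul (fmul (Finsupp.single m a) (Finsupp.single n b)) (Finsupp.single k c) =
        fmul (Finsupp.single m a) (fmul (Finsupp.single n b) (Finsupp.single k c)))
    (p q w : ℕ →₀ A) : fmul (fmul p q) w = fmul p (fmul q w) := by
  induction p using Finsupp.induction_linear with
  | zero => simp only [fmul_zero_left]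
  | add p p' hp hp' => simp only [fmul_add_left, hp, hp']
  | single m a =>
    induction q using Finsupp.induction_linear with
    | zero => simp only [fmul_zero_left, fmul_zero_right]
    | add q q' hq hq' => simp only [fmul_add_left, fmul_add_right, hq, hq']
    | single n b =>
      induction w using Finsupp.induction_linear with
      | zero => simp only [fmul_zero_right]
      | add w w' hw hw' => simp only [fmul_add_right, hw, hw']
      | single k c => exact h m n k a b c

end FlippedSkewPolynomial

/-- `B = A[X;*]^fl` is associative if and only if `A` is associative and
commutative. -/
theorem flipped_skew_polynomial_ring_associative_iff
    {A : Type*} [NonAssocRing A] [StarRing A] :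
    (∀ p q w : ℕ →₀ A, fmul (fmul p q) w = fmul p (fmul q w)) ↔
      ((∀ a b c : A, (a * b) * c = a * (b * c)) ∧ (∀ a b : A, a * b = b * a)) := by
  constructor
  · intro h
    constructor
    · intro a b c
      have := h (Finsupp.single 0 a) (Finsupp.single 0 b) (Finsupp.single 0 c)
      simp only [fmul_single_single, zero_add] at this
      simpa [tau, starIter] using Finsupp.single_injective _ this
    · intro a b
      have := h (Finsupp.single 0 a) (Finsupp.single 0 b) (Finsupp.single 1 1)
      simp only [fmul_single_single, zero_add] at this
      simpa [tau, starIter] using Finsupp.single_injective _ this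
  · rintro ⟨assoc, comm⟩
    refine fmul_assoc_of_single fun m n k a b c => ?_
    simp only [fmul_single_single, tau_eq_mul comm, starIter_mul comm, starIter_starIter, assoc,
      add_assoc]
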